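/- For all vectors a, b in H and all q ∈ [0,1], the q-numerical radius of the rank-one operator a⊗b satisfies ω_q(a⊗b) = (‖a‖·‖b‖ + q·|⟨a,b⟩|)/2 + (√(1−q²)/2)·√(‖a‖²·‖b‖² − |⟨a,b⟩|²). -/

import Mathlib

open scoped ComplexInnerProductSpace

/-- The rank-one operator `a ⊗ b` on a complex Hilbert space, acting by
`(a ⊗ b) x = ⟨x, a⟩ · b` (inner product conjugate-linear in `a`). -/
noncomputable def rankOne {H : Type*} [NormedAddCommGroup H] [InnerProductSpace ℂ H]
    (a b : H) : H →L[ℂ] H :=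
  (innerSL ℂ a).smulRight b

/-- The `q`-numerical radius `ω_q(A) = sup { |⟨Ax, y⟩| : ‖x‖ = ‖y‖ = 1, ⟨x, y⟩ = q }`. -/
noncomputable def qRad {H : Type*} [NormedAddCommGroup H] [InnerProductSpace ℂ H]
    (q : ℝ) (A : H →L[ℂ] H) : ℝ :=
  sSup {r : ℝ | ∃ x y : H, ‖x‖ = 1 ∧ ‖y‖ = 1 ∧ ⟪x, y⟫ = (q : ℂ) ∧ r = ‖⟪A x, y⟫‖}

section

variable {H : Type*} [NormedAddCommGroup H] [InnerProductSpace ℂ H]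

lemma inner_sub_proj_sub_proj {y : H} (hy : ‖y‖ = 1) (x z : H) :
    ⟪x - ⟪y, x⟫ • y, z - ⟪y, z⟫ • y⟫ = ⟪x, z⟫ - ⟪x, y⟫ * ⟪y, z⟫ := by
  simp only [inner_sub_left, inner_sub_right, inner_smul_left, inner_smul_right,
    inner_self_eq_norm_sq_to_K, hy, inner_conj_symm]
  push_cast
  ring

lemma norm_sub_proj {x y : H} (hx : ‖x‖ = 1) (hy : ‖y‖ = 1) :
    ‖x - ⟪y, x⟫ • y‖ = √(1 - ‖⟪y, x⟫‖ ^ 2) := by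
  rw [norm_eq_sqrt_re_inner (𝕜 := ℂ), inner_sub_proj_sub_proj hy, inner_self_eq_norm_sq_to_K, hx,
    ← inner_conj_symm x y, Complex.conj_mul', ← Complex.ofReal_pow]
  simp [-Complex.ofReal_pow]

lemma norm_inner_le_one {x y : H} (hx : ‖x‖ = 1) (hy : ‖y‖ = 1) : ‖⟪x, y⟫‖ ≤ 1 := by
  simpa [hx, hy] using norm_inner_le_norm (𝕜 := ℂ) x y

/-- The triangle inequality for the Fubini–Study angle. -/
lemma arccos_norm_inner_le_add {x y z : H} (hx : ‖x‖ = 1) (hy : ‖y‖ = 1) (hz : ‖z‖ = 1) :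
    Real.arccos ‖⟪x, z⟫‖ ≤ Real.arccos ‖⟪x, y⟫‖ + Real.arccos ‖⟪y, z⟫‖ := by
  have hxy := norm_inner_le_one hx hy
  have hyz := norm_inner_le_one hy hz
  have hcs := norm_inner_le_norm (𝕜 := ℂ) (x - ⟪y, x⟫ • y) (z - ⟪y, z⟫ • y)
  rw [inner_sub_proj_sub_proj hy, norm_sub_proj hx hy, norm_sub_proj hz hy,
    norm_inner_symm y x] at hcs
  have htri := norm_sub_norm_le (⟪x, y⟫ * ⟪y, z⟫) ⟪x, z⟫
  rw [norm_sub_rev, norm_mul] at htri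
  have hcos : Real.cos (Real.arccos ‖⟪x, y⟫‖ + Real.arccos ‖⟪y, z⟫‖) ≤ ‖⟪x, z⟫‖ := by
    rw [Real.cos_add, Real.sin_arccos, Real.sin_arccos,
      Real.cos_arccos (by linarith [norm_nonneg ⟪x, y⟫]) hxy,
      Real.cos_arccos (by linarith [norm_nonneg ⟪y, z⟫]) hyz]
    linarith
  calc Real.arccos ‖⟪x, z⟫‖
      ≤ Real.arccos (Real.cos (Real.arccos ‖⟪x, y⟫‖ + Real.arccos ‖⟪y, z⟫‖)) :=
        Real.arccos_le_arccos hcos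
    _ = _ := Real.arccos_cos (add_nonneg (Real.arccos_nonneg _) (Real.arccos_nonneg _)) (by
        have h1 := Real.arccos_le_pi_div_two.2 (norm_nonneg ⟪x, y⟫)
        have h2 := Real.arccos_le_pi_div_two.2 (norm_nonneg ⟪y, z⟫)
        linarith)

lemma norm_inner_mul_norm_inner_le {u v x y : H} (hu : ‖u‖ = 1) (hv : ‖v‖ = 1)
    (hx : ‖x‖ = 1) (hy : ‖y‖ = 1) :
    ‖⟪u, x⟫‖ * ‖⟪v, y⟫‖ ≤
      (1 + Real.cos (Real.arccos ‖⟪u, v⟫‖ - Real.arccos ‖⟪x, y⟫‖)) / 2 := by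
  have h1 := arccos_norm_inner_le_add hu hx hv
  have h2 := arccos_norm_inner_le_add hx hy hv
  have h3 := arccos_norm_inner_le_add hx hu hy
  have h4 := arccos_norm_inner_le_add hu hv hy
  rw [norm_inner_symm y v] at h2
  rw [norm_inner_symm x u] at h3
  have hα := Real.arccos_le_pi_div_two.2 (norm_nonneg ⟪u, x⟫)
  have hβ := Real.arccos_le_pi_div_two.2 (norm_nonneg ⟪v, y⟫)
  have hα' := Real.cos_arccos (by linarith [norm_nonneg ⟪u, x⟫]) (norm_inner_le_one hu hx)
  have hβ' := Real.cos_arccos (by linarith [norm_nonneg ⟪v, y⟫]) (norm_inner_le_one hv hy)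
  set α := Real.arccos ‖⟪u, x⟫‖
  set β := Real.arccos ‖⟪v, y⟫‖
  set θ := Real.arccos ‖⟪u, v⟫‖
  set φ := Real.arccos ‖⟪x, y⟫‖
  have hcos : Real.cos (α + β) ≤ Real.cos (θ - φ) := by
    rw [← Real.cos_abs (θ - φ)]
    exact Real.cos_le_cos_of_nonneg_of_le_pi (abs_nonneg _) (by linarith)
      (abs_le.2 ⟨by linarith, by linarith⟩)
  have hone := Real.cos_le_one (α - β)
  rw [Real.cos_add] at hcos
  rw [Real.cos_sub] at hone
  rw [← hα', ← hβ']
  linarith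

lemma exists_unit_orthogonal (hdim : 2 ≤ Module.rank ℂ H) (u : H) :
    ∃ e : H, ‖e‖ = 1 ∧ ⟪u, e⟫ = 0 := by
  have hbot : (ℂ ∙ u)ᗮ ≠ ⊥ := by
    intro h
    rw [Submodule.orthogonal_eq_bot_iff] at h
    have hle := rank_span_le (R := ℂ) ({u} : Set H)
    rw [h, rank_top, Cardinal.mk_singleton] at hle
    exact absurd (hdim.trans hle) (by norm_num)
  obtain ⟨w, hw, hw0⟩ := Submodule.exists_mem_ne_zero_of_ne_bot hbot
  refine ⟨(‖w‖⁻¹ : ℂ) • w, ?_, ?_⟩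
  · simp [norm_smul, hw0]
  · rw [inner_smul_right, Submodule.mem_orthogonal_singleton_iff_inner_right.1 hw, mul_zero]

lemma exists_frame (hdim : 2 ≤ Module.rank ℂ H) {u v : H} (hu : ‖u‖ = 1) (hv : ‖v‖ = 1) :
    ∃ e : H, ∃ ω : ℂ, ‖e‖ = 1 ∧ ⟪u, e⟫ = 0 ∧ ‖ω‖ = 1 ∧
      v = ω • ((‖⟪u, v⟫‖ : ℂ) • u + (√(1 - ‖⟪u, v⟫‖ ^ 2) : ℂ) • e) := by
  obtain ⟨ω, hω, hz⟩ := RCLike.exists_norm_mul_eq_self (⟪u, v⟫ : ℂ)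
  have hω0 : ω ≠ 0 := by
    rintro rfl
    simp at hω
  have hs := norm_sub_proj hv hu
  set w := v - ⟪u, v⟫ • u with hw
  have hvw : v = ⟪u, v⟫ • u + w := by rw [hw]; abel
  have huw : ⟪u, w⟫ = 0 := by
    simp [hw, inner_self_eq_norm_sq_to_K, hu]
  have hz' : ω * (‖⟪u, v⟫‖ : ℂ) = ⟪u, v⟫ := hz
  rw [← hs]
  by_cases hw0 : w = 0
  · obtain ⟨e, he, hue⟩ := exists_unit_orthogonal hdim u
    refine ⟨e, ω, he, hue, hω, ?_⟩
    rw [hw0, norm_zero, Complex.ofReal_zero, zero_smul, add_zero, smul_smul, hz']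
    rw [hw0, add_zero] at hvw
    exact hvw
  · have hn : (‖w‖ : ℂ) ≠ 0 := by simpa using hw0
    refine ⟨(ω * ‖w‖)⁻¹ • w, ω, ?_, ?_, hω, ?_⟩
    · simp [norm_smul, hω, hw0]
    · rw [inner_smul_right, huw, mul_zero]
    · rw [smul_add, smul_smul, smul_smul, smul_smul, hz', mul_inv_cancel₀ (mul_ne_zero hω0 hn),
        one_smul]
      exact hvw

lemma inner_cos_sin {u e : H} (hu : ‖u‖ = 1) (he : ‖e‖ = 1) (hue : ⟪u, e⟫ = 0) (s t : ℝ) :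
    ⟪(Real.cos s : ℂ) • u + (Real.sin s : ℂ) • e, (Real.cos t : ℂ) • u + (Real.sin t : ℂ) • e⟫ =
      (Real.cos (s - t) : ℂ) := by
  have heu : ⟪e, u⟫ = 0 := inner_eq_zero_symm.1 hue
  simp only [inner_add_left, inner_add_right, inner_smul_left, inner_smul_right, hue, heu,
    inner_self_eq_norm_sq_to_K, hu, he, Complex.conj_ofReal, Real.cos_sub]
  push_cast
  ring

lemma norm_cos_sin {u e : H} (hu : ‖u‖ = 1) (he : ‖e‖ = 1) (hue : ⟪u, e⟫ = 0) (t : ℝ) :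
    ‖(Real.cos t : ℂ) • u + (Real.sin t : ℂ) • e‖ = 1 := by
  rw [norm_eq_sqrt_re_inner (𝕜 := ℂ), inner_cos_sin hu he hue]
  simp

lemma exists_norm_inner_mul_norm_inner_eq (hdim : 2 ≤ Module.rank ℂ H) {u v : H}
    (hu : ‖u‖ = 1) (hv : ‖v‖ = 1) {q : ℝ} (hq : q ∈ Set.Icc (0 : ℝ) 1) :
    ∃ x y : H, ‖x‖ = 1 ∧ ‖y‖ = 1 ∧ ⟪x, y⟫ = (q : ℂ) ∧
      ‖⟪u, x⟫‖ * ‖⟪v, y⟫‖ = (1 + Real.cos (Real.arccos ‖⟪u, v⟫‖ - Real.arccos q)) / 2 := by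
  obtain ⟨e, ω, he, hue, hω, hvω⟩ := exists_frame hdim hu hv
  have hc := Real.cos_arccos (by linarith [norm_nonneg ⟪u, v⟫]) (norm_inner_le_one hu hv)
  rw [← Real.sin_arccos, ← hc, Real.arccos_cos (Real.arccos_nonneg _) (Real.arccos_le_pi _)] at hvω
  set θ := Real.arccos ‖⟪u, v⟫‖
  have hφ := Real.cos_arccos (by linarith [hq.1]) hq.2
  set φ := Real.arccos q
  refine ⟨(Real.cos ((θ - φ) / 2) : ℂ) • u + (Real.sin ((θ - φ) / 2) : ℂ) • e,
    (Real.cos ((θ + φ) / 2) : ℂ) • u + (Real.sin ((θ + φ) / 2) : ℂ) • e,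
    norm_cos_sin hu he hue _, norm_cos_sin hu he hue _, ?_, ?_⟩
  · rw [inner_cos_sin hu he hue, ← hφ, ← Real.cos_neg φ]
    ring_nf
  · have hux := inner_cos_sin hu he hue 0 ((θ - φ) / 2)
    simp only [Real.cos_zero, Real.sin_zero, Complex.ofReal_one, Complex.ofReal_zero, one_smul,
      zero_smul, add_zero, zero_sub, Real.cos_neg] at hux
    rw [hux, hvω, inner_smul_left, inner_cos_sin hu he hue, norm_mul, RCLike.norm_conj, hω, one_mul,
      show θ - (θ + φ) / 2 = (θ - φ) / 2 by ring, Complex.norm_real, Real.norm_eq_abs,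
      abs_mul_abs_self, ← sq, Real.cos_sq]
    ring_nf

lemma norm_inner_rankOne (a b x y : H) :
    ‖⟪rankOne a b x, y⟫‖ = ‖⟪a, x⟫‖ * ‖⟪b, y⟫‖ := by
  simp [rankOne, mul_comm, norm_inner_symm x a]

end

theorem stmt0 {H : Type*} [NormedAddCommGroup H] [InnerProductSpace ℂ H] [CompleteSpace H]
    (hdim : 2 ≤ Module.rank ℂ H) (a b : H) (q : ℝ) (hq : q ∈ Set.Icc (0 : ℝ) 1) :
    qRad q (rankOne a b) =
      (‖a‖ * ‖b‖ + q * ‖⟪a, b⟫‖) / 2 +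
        (Real.sqrt (1 - q ^ 2) / 2) * Real.sqrt (‖a‖ ^ 2 * ‖b‖ ^ 2 - ‖⟪a, b⟫‖ ^ 2) := by
  rcases eq_or_ne a 0 with rfl | ha
  · simp only [qRad, norm_inner_rankOne]
    simp
    exact Real.sSup_nonpos (by rintro r ⟨x, y, -, -, -, rfl⟩; exact le_rfl) |>.antisymm
      (Real.sSup_nonneg (by rintro r ⟨x, y, -, -, -, rfl⟩; exact le_rfl))
  rcases eq_or_ne b 0 with rfl | hb
  · simp only [qRad, norm_inner_rankOne]
    simp
    exact Real.sSup_nonpos (by rintro r ⟨x, y, -, -, -, rfl⟩; exact le_rfl) |>.antisymm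
      (Real.sSup_nonneg (by rintro r ⟨x, y, -, -, -, rfl⟩; exact le_rfl))
  obtain ⟨u, hu, hau⟩ : ∃ u : H, ‖u‖ = 1 ∧ a = (‖a‖ : ℂ) • u :=
    ⟨(‖a‖⁻¹ : ℂ) • a, by simp [norm_smul, ha], by simp [smul_smul, ha]⟩
  obtain ⟨v, hv, hbv⟩ : ∃ v : H, ‖v‖ = 1 ∧ b = (‖b‖ : ℂ) • v :=
    ⟨(‖b‖⁻¹ : ℂ) • b, by simp [norm_smul, hb], by simp [smul_smul, hb]⟩
  have hai (z : H) : ‖⟪a, z⟫‖ = ‖a‖ * ‖⟪u, z⟫‖ := by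
    conv_lhs => rw [hau, inner_smul_left]
    simp
  have hbi (z : H) : ‖⟪z, b⟫‖ = ‖b‖ * ‖⟪z, v⟫‖ := by
    conv_lhs => rw [hbv, inner_smul_right]
    simp
  have hc := norm_inner_le_one hu hv
  have hsqrt : √(‖a‖ ^ 2 * ‖b‖ ^ 2 - ‖⟪a, b⟫‖ ^ 2) =
      ‖a‖ * ‖b‖ * √(1 - ‖⟪u, v⟫‖ ^ 2) := by
    rw [hai, hbi, show ‖a‖ ^ 2 * ‖b‖ ^ 2 - (‖a‖ * (‖b‖ * ‖⟪u, v⟫‖)) ^ 2 =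
      (‖a‖ * ‖b‖) ^ 2 * (1 - ‖⟪u, v⟫‖ ^ 2) by ring, Real.sqrt_mul (sq_nonneg _),
      Real.sqrt_sq (by positivity)]
  have hval : (‖a‖ * ‖b‖ + q * ‖⟪a, b⟫‖) / 2 +
        (√(1 - q ^ 2) / 2) * √(‖a‖ ^ 2 * ‖b‖ ^ 2 - ‖⟪a, b⟫‖ ^ 2) =
      ‖a‖ * ‖b‖ * ((1 + Real.cos (Real.arccos ‖⟪u, v⟫‖ - Real.arccos q)) / 2) := by
    rw [hsqrt, hai, hbi, Real.cos_sub, Real.cos_arccos (by linarith [norm_nonneg ⟪u, v⟫]) hc,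
      Real.cos_arccos (by linarith [hq.1]) hq.2, Real.sin_arccos, Real.sin_arccos]
    ring
  have hprod (x y : H) : ‖⟪rankOne a b x, y⟫‖ = ‖a‖ * ‖b‖ * (‖⟪u, x⟫‖ * ‖⟪v, y⟫‖) := by
    rw [norm_inner_rankOne, hai, norm_inner_symm b, hbi, norm_inner_symm y]
    ring
  rw [hval]
  refine IsGreatest.csSup_eq ⟨?_, ?_⟩
  · obtain ⟨x, y, hx, hy, hxy, h⟩ := exists_norm_inner_mul_norm_inner_eq hdim hu hv hq
    exact ⟨x, y, hx, hy, hxy, by rw [hprod, h]⟩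
  · rintro r ⟨x, y, hx, hy, hxy, rfl⟩
    have h := norm_inner_mul_norm_inner_le hu hv hx hy
    rw [hxy, Complex.norm_of_nonneg hq.1] at h
    rw [hprod]
    gcongr
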